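/- Let X be a Polish space. If A ⊆ X has the Baire property, then A is residually measurable, i.e., the set of μ ∈ 𝓜(X) for which A is μ-measurable is comeager in 𝓜(X). -/

import Mathlib

open MeasureTheory Set Topology
open scoped ENNReal symmDiff

/-- The annihilator of a set `A`: the set of Borel probability measures `μ` on `X`
whose induced outer measure vanishes on `A`. -/
def Annihilator {X : Type*} [MeasurableSpace X] (A : Set X) :
    Set (ProbabilityMeasure X) :=
  {μ : ProbabilityMeasure X | μ.toMeasure A = 0}

/-- `A` is residually null if its annihilator is comeager in the space `𝓜(X)` of
Borel probability measures with the topology of weak convergence. -/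
def ResiduallyNull {X : Type*} [TopologicalSpace X] [MeasurableSpace X]
    [OpensMeasurableSpace X] (A : Set X) : Prop :=
  Annihilator A ∈ residual (ProbabilityMeasure X)

/-- A set has the Baire property if its symmetric difference with some open set is meager. -/
def HasBaireProperty {Y : Type*} [TopologicalSpace Y] (S : Set Y) : Prop :=
  ∃ U : Set Y, IsOpen U ∧ IsMeagre (S ∆ U)

namespace MeasureTheory.ProbabilityMeasure

theorem isOpen_setOf_measure_lt {X : Type*} [TopologicalSpace X] [MeasurableSpace X]
    [OpensMeasurableSpace X] [HasOuterApproxClosed X] {F : Set X} (hF : IsClosed F) (ε : ℝ≥0∞) :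
    IsOpen {μ : ProbabilityMeasure X | μ.toMeasure F < ε} := by
  refine isOpen_iff_mem_nhds.2 fun μ hμ ↦ ?_
  have hlim := limsup_measure_closed_le_of_tendsto (μs := id) (L := 𝓝 μ) Filter.tendsto_id hF
  exact Filter.eventually_lt_of_limsup_lt (hlim.trans_lt hμ)

theorem tendsto_map_of_tendsto {X Y : Type*} [TopologicalSpace Y] [MeasurableSpace X]
    [MeasurableSpace Y] [OpensMeasurableSpace Y] (μ : ProbabilityMeasure X)
    {T : ℕ → X → Y} {f : X → Y} (hT : ∀ n, Measurable (T n)) (hf : Measurable f)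
    (hlim : ∀ x, Filter.Tendsto (fun n ↦ T n x) Filter.atTop (𝓝 (f x))) :
    Filter.Tendsto (fun n ↦ μ.map (hT n).aemeasurable) Filter.atTop
      (𝓝 (μ.map hf.aemeasurable)) := by
  refine tendsto_iff_forall_integral_tendsto.2 fun g ↦ ?_
  have hg := g.continuous.measurable
  simp only [toMeasure_map]
  rw [integral_map hf.aemeasurable hg.aestronglyMeasurable]
  simp_rw [fun n ↦ integral_map (μ := μ.toMeasure) (hT n).aemeasurable
    hg.aestronglyMeasurable]
  exact tendsto_integral_of_dominated_convergence (fun _ ↦ ‖g‖)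
    (fun n ↦ (hg.comp (hT n)).aestronglyMeasurable) (integrable_const _)
    (fun n ↦ ae_of_all _ fun x ↦ g.norm_coe_le_norm _)
    (ae_of_all _ fun x ↦ (g.continuous.tendsto _).comp (hlim x))

open TopologicalSpace in
theorem dense_setOf_measure_compl_eq_zero {X : Type*} [TopologicalSpace X] [MeasurableSpace X]
    [BorelSpace X] [MetrizableSpace X] [SecondCountableTopology X]
    {s : Set X} (hs : Dense s) :
    Dense {μ : ProbabilityMeasure X | μ.toMeasure sᶜ = 0} := by
  let := metrizableSpaceMetric X
  intro μ
  have := μ.toMeasure.nonempty_of_neZero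
  obtain ⟨y, hy⟩ := hs.nonempty
  let T (n : ℕ) : X → X := SimpleFunc.approxOn id measurable_id s y hy n
  have hT (n : ℕ) : Measurable (T n) := SimpleFunc.measurable _
  have hlim := tendsto_map_of_tendsto μ hT measurable_id fun x ↦
    SimpleFunc.tendsto_approxOn measurable_id hy (hs x)
  have hid : μ.map measurable_id.aemeasurable = μ := Subtype.ext Measure.map_id
  rw [hid] at hlim
  refine mem_closure_of_tendsto hlim (Filter.Eventually.of_forall fun n ↦ ?_)
  change ∀ᵐ x ∂μ.toMeasure.map (T n), x ∈ s
  have hrange : MeasurableSet (range (T n)) := (SimpleFunc.finite_range _).measurableSet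
  have hmem : ∀ᵐ x ∂μ.toMeasure.map (T n), x ∈ range (T n) :=
    (ae_map_iff (hT n).aemeasurable hrange).2 (ae_of_all _ mem_range_self)
  filter_upwards [hmem] with x ⟨z, hz⟩
  exact hz ▸ SimpleFunc.approxOn_mem measurable_id hy n z

end MeasureTheory.ProbabilityMeasure

theorem IsNowhereDense.residuallyNull {X : Type*} [TopologicalSpace X] [MeasurableSpace X]
    [BorelSpace X] [TopologicalSpace.MetrizableSpace X] [SecondCountableTopology X]
    {F : Set X} (hF : IsNowhereDense F) : ResiduallyNull F := by
  have hdense : Dense (closure F)ᶜ := by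
    rw [← interior_eq_empty_iff_dense_compl]
    exact hF
  have hnull := ProbabilityMeasure.dense_setOf_measure_compl_eq_zero hdense
  rw [compl_compl] at hnull
  have hresidual : ∀ n : ℕ,
      {μ : ProbabilityMeasure X | μ.toMeasure (closure F) < (n + 1 : ℝ≥0∞)⁻¹} ∈ residual _ :=
    fun n ↦ residual_of_dense_open
      (ProbabilityMeasure.isOpen_setOf_measure_lt isClosed_closure _)
      (hnull.mono fun μ hμ ↦ by
        rw [mem_ofPred_eq] at hμ ⊢
        rw [hμ]
        exact ENNReal.inv_pos.2 (by finiteness))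
  filter_upwards [countable_iInter_mem.2 hresidual] with μ hμ
  refine measure_mono_null subset_closure (le_antisymm (le_of_forall_gt fun ε hε ↦ ?_) zero_le)
  obtain ⟨n, hn⟩ := ENNReal.exists_inv_nat_lt hε.ne'
  exact ((mem_iInter.1 hμ n).trans_le (ENNReal.inv_le_inv.2 le_self_add)).trans hn

theorem IsMeagre.residuallyNull {X : Type*} [TopologicalSpace X] [MeasurableSpace X]
    [BorelSpace X] [TopologicalSpace.MetrizableSpace X] [SecondCountableTopology X]
    {A : Set X} (hA : IsMeagre A) : ResiduallyNull A := by
  obtain ⟨S, hS, hcount, hsub⟩ := isMeagre_iff_countable_union_isNowhereDense.1 hA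
  filter_upwards [(countable_bInter_mem hcount).2 fun F hF ↦ (hS F hF).residuallyNull] with μ hμ
  exact measure_mono_null hsub ((measure_sUnion_null_iff hcount).2 fun F hF ↦ mem_iInter₂.1 hμ F hF)

/-- If `A` has the Baire property, then `A` is residually measurable: the set of
`μ ∈ 𝓜(X)` for which `A` is `μ`-measurable is comeager in `𝓜(X)`. -/
theorem baireProperty_residuallyMeasurable {X : Type*} [TopologicalSpace X] [PolishSpace X]
    [MeasurableSpace X] [BorelSpace X] (A : Set X) (h : HasBaireProperty A) :
    {μ : ProbabilityMeasure X | NullMeasurableSet A μ.toMeasure} ∈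
      residual (ProbabilityMeasure X) := by
  obtain ⟨U, hU, hAU⟩ := h
  filter_upwards [hAU.residuallyNull] with μ hμ
  exact hU.measurableSet.nullMeasurableSet.congr (measure_symmDiff_eq_zero_iff.1 hμ).symm
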